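/- Let d ≥ 1 and let c : ℝ → ℝ^{d×d} be a Borel measurable, locally bounded map such that c(t) is symmetric and non-negative definite for every t ∈ ℝ. For s ≤ r set C_{sr} = ∫_s^r c(t) dt. If u ∈ C_0^∞(ℝ^{d+1}) satisfies ∂_t u + Σ_{i,j=1}^d c_{ij}(t) ∂_{x_i x_j}^2 u = f on ℝ^{d+1}, then for every i,j ∈ {1,…,d} and every (s,x) ∈ ℝ^{d+1}, ∂_{x_i x_j}^2 u(s,x) = -∫_s^∞ dr ∫_{ℝ^d} ∂_{x_i x_j}^2 f(r, x+y) N(0, C_{sr})(dy). -/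

import Mathlib

open MeasureTheory ENNReal

/-- Time derivative `∂ₜ u` of `u : ℝ × ℝᵈ → ℝ` (time is the first coordinate). -/
noncomputable def ptime {d : ℕ} (u : ℝ × (Fin d → ℝ) → ℝ) (z : ℝ × (Fin d → ℝ)) : ℝ :=
  deriv (fun s => u (s, z.2)) z.1

/-- Spatial partial derivative `∂_{xᵢ} u` of `u : ℝ × ℝᵈ → ℝ`. -/
noncomputable def pspace {d : ℕ} (i : Fin d) (u : ℝ × (Fin d → ℝ) → ℝ)
    (z : ℝ × (Fin d → ℝ)) : ℝ :=
  fderiv ℝ (fun y => u (z.1, y)) z.2 (Pi.single i 1)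

/-- Second spatial partial derivative `∂²_{xᵢxⱼ} u` of `u : ℝ × ℝᵈ → ℝ`. -/
noncomputable def pspace2 {d : ℕ} (i j : Fin d) (u : ℝ × (Fin d → ℝ) → ℝ) :
    ℝ × (Fin d → ℝ) → ℝ :=
  pspace i (pspace j u)

open Filter Topology Set

/-- A continuous integrable function on `ℝᵈ` whose Fourier transform vanishes is zero. -/
theorem eq_zero_of_fourier_eq_zero {d : ℕ} {h : (Fin d → ℝ) → ℂ} (hc : Continuous h)
    (hi : Integrable h)
    (h0 : ∀ ξ : Fin d → ℝ,
      ∫ x, Complex.exp (-(Complex.I * ((∑ k, x k * ξ k : ℝ) : ℂ))) * h x = 0) :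
    h = 0 := by
  let H : EuclideanSpace ℝ (Fin d) → ℂ := fun z => h (WithLp.ofLp z)
  have hHc : Continuous H := hc.comp (PiLp.continuous_ofLp 2 _)
  have hHi : Integrable H :=
    (PiLp.volume_preserving_ofLp (Fin d)).integrable_comp_of_integrable hi
  have hF : FourierTransform.fourier H = 0 := by
    ext ξ
    rw [Real.fourier_eq']
    have := h0 (fun k => 2 * Real.pi * ξ k)
    rw [← (PiLp.volume_preserving_ofLp (Fin d)).integral_comp
      (MeasurableEquiv.toLp 2 (Fin d → ℝ)).symm.measurableEmbedding] at this
    rw [Pi.zero_apply, ← this]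
    congr 1
    ext z
    simp only [smul_eq_mul, H, PiLp.inner_apply]
    congr 2
    push_cast
    simp only [RCLike.inner_apply, conj_trivial, Finset.mul_sum, Finset.sum_mul]
    rw [← Finset.sum_neg_distrib]
    refine Finset.sum_congr rfl fun k _ => ?_
    push_cast
    ring
  have hHz := hHc.fourierInv_fourier_eq hHi (by rw [hF]; exact integrable_zero _ _ _)
  ext x
  have := congrFun hHz (WithLp.toLp 2 x)
  rw [hF, Real.fourierInv_eq'] at this
  simpa [H] using this.symm

/-- Integrals of bounded continuous functions depend continuously on the parameter of a family of
probability measures as soon as the characteristic functions do. -/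
theorem continuous_integral_of_continuous_charFun {d : ℕ} {P : ℝ → Measure (Fin d → ℝ)}
    [hP : ∀ r, IsProbabilityMeasure (P r)]
    (h : ∀ ξ : Fin d → ℝ,
      Continuous fun r => ∫ y, Complex.exp (Complex.I * ((∑ k, y k * ξ k : ℝ) : ℂ)) ∂(P r))
    (φ : BoundedContinuousFunction (Fin d → ℝ) ℝ) :
    Continuous fun r => ∫ y, φ y ∂(P r) := by
  let e := MeasurableEquiv.toLp 2 (Fin d → ℝ)
  have hQ (r) : IsProbabilityMeasure ((P r).map e) :=
    Measure.isProbabilityMeasure_map e.measurable.aemeasurable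
  let Q (r : ℝ) : ProbabilityMeasure (EuclideanSpace ℝ (Fin d)) := ⟨(P r).map e, hQ r⟩
  let ψ : BoundedContinuousFunction (EuclideanSpace ℝ (Fin d)) ℝ :=
    φ.compContinuous ⟨WithLp.ofLp, PiLp.continuous_ofLp 2 _⟩
  have hψ (r) : ∫ y, φ y ∂(P r) = ∫ z, ψ z ∂(Q r : Measure (EuclideanSpace ℝ (Fin d))) :=
    (integral_map_equiv e ψ).symm
  refine continuous_iff_seqContinuous.2 fun u r hu => ?_
  simp only [Function.comp_def, hψ]
  refine ProbabilityMeasure.tendsto_iff_forall_integral_tendsto.1 ?_ ψ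
  refine ProbabilityMeasure.tendsto_iff_tendsto_charFun (μ := fun n => Q (u n)).2 fun ξ => ?_
  have hch (r) : charFun (Q r : Measure (EuclideanSpace ℝ (Fin d))) ξ
      = ∫ y, Complex.exp (Complex.I * ((∑ k, y k * ξ k : ℝ) : ℂ)) ∂(P r) := by
    rw [charFun_apply]
    refine (integral_map_equiv e _).trans ?_
    congr 1
    ext y
    rw [mul_comm]
    congr 3
    simp [e, PiLp.inner_apply, mul_comm]
  simp only [hch]
  exact ((h ξ).tendsto r).comp hu

/-- The mean of `A (r, x + ·)` under the measure `P r`. -/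
noncomputable def shiftMean {d : ℕ} (P : ℝ → Measure (Fin d → ℝ)) (A : ℝ × (Fin d → ℝ) → ℝ)
    (r : ℝ) (x : Fin d → ℝ) : ℝ :=
  ∫ y, A (r, x + y) ∂(P r)

theorem continuous_shiftMean {d : ℕ} {P : ℝ → Measure (Fin d → ℝ)}
    [hP : ∀ r, IsProbabilityMeasure (P r)]
    (h : ∀ φ : BoundedContinuousFunction (Fin d → ℝ) ℝ, Continuous fun r => ∫ y, φ y ∂(P r))
    {A : ℝ × (Fin d → ℝ) → ℝ} (hA : Continuous A) (hAs : HasCompactSupport A) :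
    Continuous fun p : ℝ × (Fin d → ℝ) => shiftMean P A p.1 p.2 := by
  obtain ⟨M, hM⟩ := hAs.exists_bound_of_continuous hA
  have hint (r x r') : Integrable (fun y => A (r, x + y)) (P r') :=
    Integrable.of_bound (by fun_prop) M (.of_forall fun y => hM _)
  refine continuous_iff_continuousAt.2 fun p₀ => ?_
  let φ : BoundedContinuousFunction (Fin d → ℝ) ℝ :=
    BoundedContinuousFunction.ofNormedAddCommGroup (fun y => A (p₀.1, p₀.2 + y))
      (by fun_prop) M fun y => hM _
  have h1 : Tendsto (fun p : ℝ × (Fin d → ℝ) => ∫ y, φ y ∂(P p.1)) (𝓝 p₀)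
      (𝓝 (shiftMean P A p₀.1 p₀.2)) := ((h φ).comp continuous_fst).tendsto p₀
  have h2 : Tendsto (fun p : ℝ × (Fin d → ℝ) => ∫ y, (A (p.1, p.2 + y) - φ y) ∂(P p.1)) (𝓝 p₀)
      (𝓝 0) := by
    refine Metric.tendsto_nhds.2 fun ε hε => ?_
    obtain ⟨δ, hδ, H⟩ := Metric.uniformContinuous_iff.1
      (hAs.uniformContinuous_of_continuous hA) (ε / 2) (by positivity)
    filter_upwards [Metric.ball_mem_nhds p₀ hδ] with p hp
    rw [dist_zero_right]
    refine (norm_integral_le_of_norm_le_const (C := ε / 2) (.of_forall fun y => ?_)).trans_lt ?_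
    · rw [← dist_eq_norm]
      refine (H ?_).le
      simpa [Prod.dist_eq] using hp
    · simpa using hε
  refine (add_zero (shiftMean P A p₀.1 p₀.2) ▸ h1.add h2).congr fun p => ?_
  rw [integral_sub (hint _ _ _) (show Integrable (fun y => φ y) _ from hint _ _ _), shiftMean]
  ring

/-- Averaging the translates of an integrable function over a probability measure multiplies its
Fourier transform by the characteristic function of the measure. -/
theorem integrable_and_fourier_mean_translates {d : ℕ} (μ : Measure (Fin d → ℝ))
    [IsProbabilityMeasure μ] {a : (Fin d → ℝ) → ℝ} (hc : Continuous a) (hi : Integrable a) :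
    Integrable (fun x => ∫ y, a (x + y) ∂μ) ∧ (∫ x, ‖∫ y, a (x + y) ∂μ‖) ≤ (∫ x, ‖a x‖) ∧
    ∀ ξ : Fin d → ℝ,
      ∫ x, Complex.exp (-(Complex.I * ((∑ k, x k * ξ k : ℝ) : ℂ))) * ((∫ y, a (x + y) ∂μ : ℝ) : ℂ)
      = (∫ y, Complex.exp (Complex.I * ((∑ k, y k * ξ k : ℝ) : ℂ)) ∂μ) *
        ∫ x, Complex.exp (-(Complex.I * ((∑ k, x k * ξ k : ℝ) : ℂ))) * (a x : ℂ) := by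
  have hprod : Integrable (fun p : (Fin d → ℝ) × (Fin d → ℝ) => a (p.1 + p.2))
      (volume.prod μ) := by
    refine (integrable_prod_iff' (by fun_prop)).2 ⟨.of_forall fun y => hi.comp_add_right y, ?_⟩
    simp_rw [integral_add_right_eq_self (fun x => ‖a x‖)]
    exact integrable_const _
  refine ⟨hprod.integral_prod_left, ?_, fun ξ => ?_⟩
  · calc (∫ x, ‖∫ y, a (x + y) ∂μ‖) ≤ ∫ x, ∫ y, ‖a (x + y)‖ ∂μ :=
          integral_mono hprod.integral_prod_left.norm hprod.norm.integral_prod_left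
            fun x => norm_integral_le_integral_norm _
      _ = ∫ y, (∫ x, ‖a (x + y)‖) ∂μ :=
          integral_integral_swap (f := fun x y => ‖a (x + y)‖) hprod.norm
      _ = ∫ x, ‖a x‖ := by
          simp_rw [integral_add_right_eq_self (fun x => ‖a x‖)]
          simp
  · have hprod' : Integrable (Function.uncurry fun x y : Fin d → ℝ =>
        Complex.exp (-(Complex.I * ((∑ k, x k * ξ k : ℝ) : ℂ))) * (a (x + y) : ℂ))
        (volume.prod μ) := by
      refine hprod.ofReal.bdd_mul (c := 1) (by fun_prop) (.of_forall fun p => ?_)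
      simp [Complex.norm_exp]
    have hin (x : Fin d → ℝ) :
        Complex.exp (-(Complex.I * ((∑ k, x k * ξ k : ℝ) : ℂ))) * ((∫ y, a (x + y) ∂μ : ℝ) : ℂ)
        = ∫ y, Complex.exp (-(Complex.I * ((∑ k, x k * ξ k : ℝ) : ℂ))) * (a (x + y) : ℂ) ∂μ := by
      rw [← integral_complex_ofReal, ← integral_const_mul]
    simp_rw [hin]
    rw [integral_integral_swap hprod', ← integral_mul_const]
    congr 1
    ext y
    rw [← integral_add_right_eq_self (fun x => Complex.exp (-(Complex.I * _)) * (a x : ℂ)) y,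
      ← integral_const_mul]
    congr 1
    ext x
    rw [← mul_assoc, ← Complex.exp_add]
    congr 2
    simp only [Pi.add_apply, add_mul, Finset.sum_add_distrib]
    push_cast
    ring

/-- A continuous compactly supported function on `ℝ × ℝᵈ` vanishes for large times and is dominated,
uniformly in time, by a multiple of the indicator of a ball. -/
theorem exists_uniform_bound {d : ℕ} {A : ℝ × (Fin d → ℝ) → ℝ} (hA : Continuous A)
    (hAs : HasCompactSupport A) :
    ∃ R M : ℝ, 0 ≤ M ∧ (∀ z, ‖A z‖ ≤ M) ∧ (∀ r ∉ Icc (-R) R, ∀ x, A (r, x) = 0) ∧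
      ∀ r x, ‖A (r, x)‖ ≤ (Metric.closedBall (0 : Fin d → ℝ) R).indicator (fun _ => M) x := by
  obtain ⟨M, hM⟩ := hAs.exists_bound_of_continuous hA
  obtain ⟨R, hR⟩ := hAs.isCompact.isBounded.subset_closedBall 0
  have hz (z) (h : R < ‖z‖) : A z = 0 := by
    by_contra hne
    have := hR (subset_tsupport A hne)
    rw [mem_closedBall_zero_iff] at this
    linarith
  refine ⟨R, M, (norm_nonneg _).trans (hM 0), hM, fun r hr x => hz _ ?_, fun r x => ?_⟩
  · rw [mem_Icc, ← abs_le, not_le] at hr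
    exact hr.trans_le (norm_fst_le (r, x))
  · by_cases hx : x ∈ Metric.closedBall (0 : Fin d → ℝ) R
    · rw [indicator_of_mem hx]
      exact hM _
    · rw [indicator_of_notMem hx, hz, norm_zero]
      rw [mem_closedBall_zero_iff, not_le] at hx
      exact hx.trans_le (norm_snd_le (r, x))

theorem integrable_indicator_closedBall {d : ℕ} (R M : ℝ) :
    Integrable ((Metric.closedBall (0 : Fin d → ℝ) R).indicator (fun _ => M)) :=
  (integrable_indicator_iff Metric.isClosed_closedBall.measurableSet).2
    (integrableOn_const measure_closedBall_lt_top.ne)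

theorem integrable_slice {d : ℕ} {A : ℝ × (Fin d → ℝ) → ℝ} (hA : Continuous A)
    (hAs : HasCompactSupport A) (r : ℝ) : Integrable fun x => A (r, x) := by
  obtain ⟨R, M, -, -, -, hB⟩ := exists_uniform_bound hA hAs
  exact (integrable_indicator_closedBall R M).mono' (by fun_prop) (.of_forall fun x => hB r x)

/-- Regularity and Fourier transform of the time integral of averaged translates. -/
theorem time_integral_shiftMean {d : ℕ} {P : ℝ → Measure (Fin d → ℝ)}
    [hP : ∀ r, IsProbabilityMeasure (P r)]
    (h : ∀ φ : BoundedContinuousFunction (Fin d → ℝ) ℝ, Continuous fun r => ∫ y, φ y ∂(P r))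
    {A : ℝ × (Fin d → ℝ) → ℝ} (hA : Continuous A) (hAs : HasCompactSupport A)
    {b : ℝ → ℝ} (hb : Measurable b) (hbl : ∀ R, ∃ K : ℝ, ∀ t ∈ Icc (-R) R, |b t| ≤ K) (s : ℝ) :
    (∀ x, IntegrableOn (fun r => b r * shiftMean P A r x) (Ioi s)) ∧
    Continuous (fun x => ∫ r in Ioi s, b r * shiftMean P A r x) ∧
    Integrable (fun x => ∫ r in Ioi s, b r * shiftMean P A r x) ∧
    ∀ ξ : Fin d → ℝ,
      IntegrableOn (fun r => (b r : ℂ) *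
        ((∫ y, Complex.exp (Complex.I * ((∑ k, y k * ξ k : ℝ) : ℂ)) ∂(P r)) *
        ∫ x, Complex.exp (-(Complex.I * ((∑ k, x k * ξ k : ℝ) : ℂ))) * (A (r, x) : ℂ))) (Ioi s) ∧
      ∫ x, Complex.exp (-(Complex.I * ((∑ k, x k * ξ k : ℝ) : ℂ))) *
          ((∫ r in Ioi s, b r * shiftMean P A r x : ℝ) : ℂ)
        = ∫ r in Ioi s, (b r : ℂ) *
          ((∫ y, Complex.exp (Complex.I * ((∑ k, y k * ξ k : ℝ) : ℂ)) ∂(P r)) *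
          ∫ x, Complex.exp (-(Complex.I * ((∑ k, x k * ξ k : ℝ) : ℂ))) * (A (r, x) : ℂ)) := by
  obtain ⟨R, M, hM0, hM, hR, hB⟩ := exists_uniform_bound hA hAs
  obtain ⟨K, hK⟩ := hbl R
  have hT := continuous_shiftMean h hA hAs
  have hmean (r : ℝ) := integrable_and_fourier_mean_translates (P r)
    (a := fun x => A (r, x)) (by fun_prop) (integrable_slice hA hAs r)
  have hT0 (r : ℝ) (hr : r ∉ Icc (-R) R) (x) : shiftMean P A r x = 0 := by
    simp [shiftMean, hR r hr]
  have hind (C : ℝ) : Integrable ((Icc (-R) R).indicator fun _ => C) (volume.restrict (Ioi s)) :=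
    ((integrable_indicator_iff measurableSet_Icc).2
      (integrableOn_const measure_Icc_lt_top.ne)).restrict
  have hbound (r : ℝ) (x : Fin d → ℝ) :
      ‖b r * shiftMean P A r x‖ ≤ (Icc (-R) R).indicator (fun _ => K * M) r := by
    by_cases hr : r ∈ Icc (-R) R
    · rw [indicator_of_mem hr, norm_mul]
      refine mul_le_mul (hK r hr) ?_ (norm_nonneg _) ((abs_nonneg _).trans (hK r hr))
      refine (norm_integral_le_of_norm_le_const (C := M) (.of_forall fun y => hM _)).trans ?_
      simp
    · rw [indicator_of_notMem hr, hT0 r hr, mul_zero, norm_zero]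
  have hmeas : Measurable fun p : ℝ × (Fin d → ℝ) => b p.1 * shiftMean P A p.1 p.2 :=
    (hb.comp measurable_fst).mul hT.measurable
  have hprod : Integrable (fun p : ℝ × (Fin d → ℝ) => b p.1 * shiftMean P A p.1 p.2)
      ((volume.restrict (Ioi s)).prod volume) := by
    refine (integrable_prod_iff hmeas.aestronglyMeasurable).2
      ⟨.of_forall fun r => (hmean r).1.const_mul (b r), ?_⟩
    refine (hind (K * ∫ x, (Metric.closedBall (0 : Fin d → ℝ) R).indicator (fun _ => M) x)).mono'
      hmeas.aestronglyMeasurable.norm.integral_prod_right' (.of_forall fun r => ?_)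
    rw [Real.norm_of_nonneg (integral_nonneg fun _ => norm_nonneg _)]
    by_cases hr : r ∈ Icc (-R) R
    · rw [indicator_of_mem hr]
      simp_rw [norm_mul]
      rw [integral_const_mul]
      refine mul_le_mul (hK r hr) ((hmean r).2.1.trans ?_) (integral_nonneg fun _ => norm_nonneg _)
        ((abs_nonneg _).trans (hK r hr))
      exact integral_mono (integrable_slice hA hAs r).norm (integrable_indicator_closedBall R M)
        (hB r)
    · simp [indicator_of_notMem hr, hT0 r hr]
  refine ⟨fun x => (hind (K * M)).mono'
      (hmeas.comp measurable_prodMk_right).aestronglyMeasurable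
      (.of_forall fun r => hbound r x), ?_, hprod.integral_prod_right, fun ξ => ?_⟩
  · refine continuous_of_dominated (fun x =>
      (hmeas.comp measurable_prodMk_right).aestronglyMeasurable)
      (fun x => .of_forall fun r => hbound r x) (hind (K * M)) (.of_forall fun r => ?_)
    exact continuous_const.mul (hT.comp (by fun_prop : Continuous fun x : Fin d → ℝ => (r, x)))
  · have hprod' : Integrable (fun p : ℝ × (Fin d → ℝ) =>
        Complex.exp (-(Complex.I * ((∑ k, p.2 k * ξ k : ℝ) : ℂ))) *
          ((b p.1 * shiftMean P A p.1 p.2 : ℝ) : ℂ))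
        ((volume.restrict (Ioi s)).prod volume) := by
      refine hprod.ofReal.bdd_mul (c := 1) (by fun_prop) (.of_forall fun p => ?_)
      simp [Complex.norm_exp]
    have hin (r : ℝ) : ∫ x, Complex.exp (-(Complex.I * ((∑ k, x k * ξ k : ℝ) : ℂ))) *
          ((b r * shiftMean P A r x : ℝ) : ℂ) = (b r : ℂ) *
        ((∫ y, Complex.exp (Complex.I * ((∑ k, y k * ξ k : ℝ) : ℂ)) ∂(P r)) *
        ∫ x, Complex.exp (-(Complex.I * ((∑ k, x k * ξ k : ℝ) : ℂ))) * (A (r, x) : ℂ)) := by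
      rw [← (hmean r).2.2 ξ, ← integral_const_mul]
      congr 1
      ext x
      simp only [shiftMean]
      push_cast
      ring
    refine ⟨hprod'.integral_prod_left.congr (.of_forall hin), ?_⟩
    simp_rw [← hin]
    rw [integral_integral_swap hprod']
    congr 1
    ext x
    rw [← integral_complex_ofReal, ← integral_const_mul]

theorem intervalIntegrable_of_locally_bounded {q : ℝ → ℝ} (hq : Measurable q)
    (hql : ∀ a b : ℝ, ∃ K : ℝ, ∀ t ∈ Icc a b, |q t| ≤ K) (a b : ℝ) :
    IntervalIntegrable q volume a b := by
  obtain ⟨K, hK⟩ := hql (min a b) (max a b)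
  rw [intervalIntegrable_iff']
  exact Measure.integrableOn_of_bounded (M := K) measure_Icc_lt_top.ne hq.aestronglyMeasurable
    ((ae_restrict_iff' measurableSet_uIcc).2 (.of_forall hK))

/-- Integrated form of `(e^{-∫q} w)' = e^{-∫q} (w' - q w)` for locally bounded `q`. -/
theorem integral_exp_neg_primitive_mul {q : ℝ → ℝ} (hq : Measurable q)
    (hql : ∀ a b : ℝ, ∃ K : ℝ, ∀ t ∈ Icc a b, |q t| ≤ K)
    {w w' : ℝ → ℝ} (hw : ∀ r, HasDerivAt w (w' r) r) (hw' : Continuous w') {R : ℝ}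
    (hR : ∀ r, R < r → w r = 0 ∧ w' r = 0) (s : ℝ) :
    ∫ r in Ioi s, Real.exp (-∫ t in s..r, q t) * (w' r - q r * w r) = -w s := by
  obtain ⟨b, hsb, hRb⟩ : ∃ b, s < b ∧ R < b :=
    ⟨max s R + 1, by linarith [le_max_left s R], by linarith [le_max_right s R]⟩
  have hqi := intervalIntegrable_of_locally_bounded hq hql s b
  have hQ : AbsolutelyContinuousOnInterval (fun r => ∫ t in s..r, q t) s b :=
    hqi.absolutelyContinuousOnInterval_intervalIntegral left_mem_uIcc
  have hE : AbsolutelyContinuousOnInterval (fun r => Real.exp (-∫ t in s..r, q t)) s b := by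
    obtain ⟨K, hK⟩ := hql s b
    have hLip : LipschitzOnWith (Real.toNNReal K) (fun r => ∫ t in s..r, q t) (uIcc s b) := by
      refine LipschitzOnWith.of_dist_le_mul fun x hx y hy => ?_
      rw [uIcc_of_le hsb.le] at hx hy
      rw [Real.dist_eq, Real.dist_eq, intervalIntegral.integral_interval_sub_left
        (intervalIntegrable_of_locally_bounded hq hql _ _)
        (intervalIntegrable_of_locally_bounded hq hql _ _), ← Real.norm_eq_abs]
      refine intervalIntegral.norm_integral_le_of_norm_le_const fun t ht => ?_
      have ht' := uIoc_subset_uIcc ht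
      exact (hK t (uIcc_subset_Icc hy hx ht')).trans (Real.le_coe_toNNReal K)
    obtain ⟨C, hC⟩ := hQ.exists_bound
    obtain ⟨K', hK'⟩ := (Real.contDiff_exp.comp contDiff_neg).contDiffOn.exists_lipschitzOnWith
      (n := 1) one_ne_zero (convex_Icc (-C) C) isCompact_Icc
    exact (hK'.comp hLip fun r hr => abs_le.1 (hC r hr)).absolutelyContinuousOnInterval
  have hwd : ContDiff ℝ 1 w := by
    refine contDiff_one_iff_deriv.2 ⟨fun r => (hw r).differentiableAt, ?_⟩
    rwa [show deriv w = w' from funext fun r => (hw r).deriv]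
  have hg := hE.fun_mul hwd.contDiffOn.absolutelyContinuousOnInterval
  have key := hg.integral_deriv_eq_sub
  simp only [(hR b hRb).1, intervalIntegral.integral_same] at key
  rw [neg_zero, Real.exp_zero, mul_zero, one_mul, zero_sub] at key
  rw [← key, intervalIntegral.integral_of_le hsb.le,
    setIntegral_eq_of_subset_of_forall_sdiff_eq_zero measurableSet_Ioi
      (Ioc_subset_Ioi_self : Ioc s b ⊆ Ioi s)]
  · refine setIntegral_congr_ae measurableSet_Ioc ?_
    filter_upwards [hqi.ae_hasDerivAt_integral] with r hr hrs
    have hr' : r ∈ uIcc s b := by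
      rw [uIcc_of_le hsb.le]
      exact Ioc_subset_Icc_self hrs
    refine Eq.trans ?_ ((hr hr' s left_mem_uIcc).neg.exp.mul (hw r)).deriv.symm
    simp only [Pi.neg_apply]
    ring
  · intro r hr
    have : b < r := by
      by_contra hlt
      exact hr.2 ⟨hr.1, not_lt.1 hlt⟩
    rw [(hR r (hRb.trans this)).1, (hR r (hRb.trans this)).2]
    simp

theorem integral_exp_neg_primitive_mul_complex {q : ℝ → ℝ} (hq : Measurable q)
    (hql : ∀ a b : ℝ, ∃ K : ℝ, ∀ t ∈ Icc a b, |q t| ≤ K)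
    {w w' : ℝ → ℂ} (hw : ∀ r, HasDerivAt w (w' r) r) (hw' : Continuous w') {R : ℝ}
    (hR : ∀ r, R < r → w r = 0 ∧ w' r = 0) (s : ℝ)
    (hi : IntegrableOn
      (fun r => Complex.exp (-((∫ t in s..r, q t : ℝ) : ℂ)) * (w' r - q r * w r)) (Ioi s)) :
    ∫ r in Ioi s, Complex.exp (-((∫ t in s..r, q t : ℝ) : ℂ)) * (w' r - q r * w r) = -w s := by
  have hexp (r : ℝ) : Complex.exp (-((∫ t in s..r, q t : ℝ) : ℂ))
      = ((Real.exp (-∫ t in s..r, q t) : ℝ) : ℂ) := by push_cast; rfl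
  simp only [hexp] at hi ⊢
  apply Complex.ext
  · refine (Complex.reCLM.integral_comp_comm hi).symm.trans ?_
    refine Eq.trans ?_ (integral_exp_neg_primitive_mul hq hql (w := fun r => (w r).re)
      (w' := fun r => (w' r).re) (fun r => Complex.reCLM.hasFDerivAt.comp_hasDerivAt r (hw r))
      (Complex.continuous_re.comp hw') (R := R) (fun r hr => by simp [hR r hr]) s)
    simp only [Complex.reCLM_apply, Complex.re_ofReal_mul, Complex.sub_re]
  · refine (Complex.imCLM.integral_comp_comm hi).symm.trans ?_
    refine Eq.trans ?_ (integral_exp_neg_primitive_mul hq hql (w := fun r => (w r).im)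
      (w' := fun r => (w' r).im) (fun r => Complex.imCLM.hasFDerivAt.comp_hasDerivAt r (hw r))
      (Complex.continuous_im.comp hw') (R := R) (fun r hr => by simp [hR r hr]) s)
    simp only [Complex.imCLM_apply, Complex.im_ofReal_mul, Complex.sub_im]

theorem ptime_eq_fderiv {d : ℕ} {A : ℝ × (Fin d → ℝ) → ℝ} (hA : ContDiff ℝ (⊤ : ℕ∞) A) :
    ptime A = fun z => fderiv ℝ A z (1, 0) := by
  ext z
  have h := (hA.differentiable (by simp) z).hasFDerivAt.comp_hasDerivAt_of_eq z.1
    ((hasDerivAt_id z.1).prodMk (hasDerivAt_const z.1 z.2)) rfl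
  exact h.deriv

theorem pspace_eq_fderiv {d : ℕ} {A : ℝ × (Fin d → ℝ) → ℝ} (hA : ContDiff ℝ (⊤ : ℕ∞) A)
    (i : Fin d) : pspace i A = fun z => fderiv ℝ A z (0, Pi.single i 1) := by
  ext z
  have h := HasFDerivAt.comp (f := fun y => (z.1, y)) z.2
    (hA.differentiable (by simp) z).hasFDerivAt
    ((hasFDerivAt_const z.1 z.2).prodMk (hasFDerivAt_id z.2))
  have := congrArg (fun L => L (Pi.single i 1)) h.fderiv
  simpa [pspace, Function.comp_def] using this

theorem contDiff_fderiv_apply_const {E : Type*} [NormedAddCommGroup E] [NormedSpace ℝ E]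
    {A : E → ℝ} (hA : ContDiff ℝ (⊤ : ℕ∞) A) (v : E) :
    ContDiff ℝ (⊤ : ℕ∞) fun z => fderiv ℝ A z v :=
  (hA.fderiv_right (by simp)).clm_apply contDiff_const

theorem fderiv_fderiv_apply_comm {E : Type*} [NormedAddCommGroup E] [NormedSpace ℝ E]
    {A : E → ℝ} (hA : ContDiff ℝ (⊤ : ℕ∞) A) (v w z : E) :
    fderiv ℝ (fun z => fderiv ℝ A z v) z w = fderiv ℝ (fun z => fderiv ℝ A z w) z v := by
  have hd : DifferentiableAt ℝ (fderiv ℝ A) z :=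
    (hA.fderiv_right (m := (⊤ : ℕ∞)) (by simp)).differentiable (by simp) z
  have hs : IsSymmSndFDerivAt ℝ A z :=
    hA.contDiffAt.isSymmSndFDerivAt (by simpa using WithTop.coe_le_coe.2 (le_top (a := (2 : ℕ∞))))
  have hap (v' : E) : fderiv ℝ (fun z => fderiv ℝ A z v') z = (fderiv ℝ (fderiv ℝ A) z).flip v' := by
    rw [fderiv_clm_apply hd (differentiableAt_const _)]
    simp
  rw [hap, hap]
  exact hs.eq w v

theorem contDiff_ptime {d : ℕ} {A : ℝ × (Fin d → ℝ) → ℝ} (hA : ContDiff ℝ (⊤ : ℕ∞) A) :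
    ContDiff ℝ (⊤ : ℕ∞) (ptime A) :=
  ptime_eq_fderiv hA ▸ contDiff_fderiv_apply_const hA _

theorem contDiff_pspace {d : ℕ} {A : ℝ × (Fin d → ℝ) → ℝ} (hA : ContDiff ℝ (⊤ : ℕ∞) A)
    (i : Fin d) : ContDiff ℝ (⊤ : ℕ∞) (pspace i A) :=
  pspace_eq_fderiv hA i ▸ contDiff_fderiv_apply_const hA _

theorem hasCompactSupport_ptime {d : ℕ} {A : ℝ × (Fin d → ℝ) → ℝ} (hA : ContDiff ℝ (⊤ : ℕ∞) A)
    (hAs : HasCompactSupport A) : HasCompactSupport (ptime A) :=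
  ptime_eq_fderiv hA ▸ hAs.fderiv_apply ℝ _

theorem hasCompactSupport_pspace {d : ℕ} {A : ℝ × (Fin d → ℝ) → ℝ}
    (hA : ContDiff ℝ (⊤ : ℕ∞) A) (hAs : HasCompactSupport A) (i : Fin d) :
    HasCompactSupport (pspace i A) :=
  pspace_eq_fderiv hA i ▸ hAs.fderiv_apply ℝ _

theorem pspace_comm {d : ℕ} {A : ℝ × (Fin d → ℝ) → ℝ} (hA : ContDiff ℝ (⊤ : ℕ∞) A)
    (i j : Fin d) : pspace i (pspace j A) = pspace j (pspace i A) := by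
  rw [pspace_eq_fderiv (contDiff_pspace hA j), pspace_eq_fderiv (contDiff_pspace hA i),
    pspace_eq_fderiv hA i, pspace_eq_fderiv hA j]
  exact funext fun z => fderiv_fderiv_apply_comm hA _ _ z

theorem pspace_ptime_comm {d : ℕ} {A : ℝ × (Fin d → ℝ) → ℝ} (hA : ContDiff ℝ (⊤ : ℕ∞) A)
    (i : Fin d) : pspace i (ptime A) = ptime (pspace i A) := by
  rw [pspace_eq_fderiv (contDiff_ptime hA), ptime_eq_fderiv (contDiff_pspace hA i),
    pspace_eq_fderiv hA i, ptime_eq_fderiv hA]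
  exact funext fun z => fderiv_fderiv_apply_comm hA _ _ z

theorem pspace_add_sum {d : ℕ} {A₀ : ℝ × (Fin d → ℝ) → ℝ} (hA₀ : ContDiff ℝ (⊤ : ℕ∞) A₀)
    {A : Fin d → Fin d → ℝ × (Fin d → ℝ) → ℝ} (hA : ∀ k l, ContDiff ℝ (⊤ : ℕ∞) (A k l))
    (c : ℝ → Matrix (Fin d) (Fin d) ℝ) (i : Fin d) :
    pspace i (fun z => A₀ z + ∑ k, ∑ l, c z.1 k l * A k l z)
      = fun z => pspace i A₀ z + ∑ k, ∑ l, c z.1 k l * pspace i (A k l) z := by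
  ext z
  have hs {B : ℝ × (Fin d → ℝ) → ℝ} (hB : ContDiff ℝ (⊤ : ℕ∞) B) :
      HasFDerivAt (fun y => B (z.1, y)) (fderiv ℝ (fun y => B (z.1, y)) z.2) z.2 :=
    ((hB.comp (contDiff_prodMk_right z.1)).differentiable (by simp) z.2).hasFDerivAt
  have h := (hs hA₀).add (HasFDerivAt.fun_sum (u := Finset.univ) fun k _ =>
    HasFDerivAt.fun_sum (u := Finset.univ) fun l _ => (hs (hA k l)).const_mul (c z.1 k l))
  refine (congrArg (fun L => L (Pi.single i 1)) h.fderiv).trans ?_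
  simp [pspace]

/-- Space differentiation of a compactly supported function multiplies its Fourier transform in
space by the frequency. -/
theorem fourier_pspace {d : ℕ} {A : ℝ × (Fin d → ℝ) → ℝ} (hA : ContDiff ℝ (⊤ : ℕ∞) A)
    (hAs : HasCompactSupport A) (i : Fin d) (r : ℝ) (ξ : Fin d → ℝ) :
    ∫ x, Complex.exp (-(Complex.I * ((∑ k, x k * ξ k : ℝ) : ℂ))) * (pspace i A (r, x) : ℂ)
      = Complex.I * ξ i *
        ∫ x, Complex.exp (-(Complex.I * ((∑ k, x k * ξ k : ℝ) : ℂ))) * (A (r, x) : ℂ) := by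
  let e (x : Fin d → ℝ) : ℂ := Complex.exp (-(Complex.I * ((∑ k, x k * ξ k : ℝ) : ℂ)))
  have he : ContDiff ℝ 1 e := by
    have h1 : ContDiff ℝ 1 fun x : Fin d → ℝ => ∑ k, x k * ξ k := by fun_prop
    exact (contDiff_const.mul (Complex.ofRealCLM.contDiff.comp h1)).neg.cexp
  have hed (x) : fderiv ℝ e x (Pi.single i 1) = -(Complex.I * ξ i) * e x := by
    have h1 : HasFDerivAt (fun x : Fin d → ℝ => ∑ k, x k * ξ k)
        (∑ k, ξ k • ContinuousLinearMap.proj (R := ℝ) (φ := fun _ => ℝ) k) x :=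
      HasFDerivAt.fun_sum fun k _ => (hasFDerivAt_apply k x).mul_const (ξ k)
    have h2 := ((Complex.ofRealCLM.hasFDerivAt.comp x h1).const_mul Complex.I).neg.cexp
    refine (congrArg (fun L => L (Pi.single i 1)) h2.fderiv).trans ?_
    simp [e, Pi.single_apply]
    ring
  have hen (x) : ‖e x‖ ≤ 1 := by simp [e, Complex.norm_exp]
  have hAr : ContDiff ℝ (⊤ : ℕ∞) fun x => A (r, x) := hA.comp (contDiff_prodMk_right r)
  have hgd (x) : HasFDerivAt (fun x => (A (r, x) : ℂ))
      (Complex.ofRealCLM.comp (fderiv ℝ (fun x => A (r, x)) x)) x :=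
    Complex.ofRealCLM.hasFDerivAt.comp x (hAr.differentiable (by simp) x).hasFDerivAt
  have hgd' (x) : fderiv ℝ (fun x => (A (r, x) : ℂ)) x (Pi.single i 1)
      = (pspace i A (r, x) : ℂ) := by
    rw [(hgd x).fderiv]
    rfl
  have hint {B : ℝ × (Fin d → ℝ) → ℝ} (hB : Continuous B) (hBs : HasCompactSupport B) :
      Integrable fun x => e x * (B (r, x) : ℂ) :=
    (integrable_slice hB hBs r).ofReal.bdd_mul (c := 1) he.continuous.aestronglyMeasurable
      (.of_forall hen)
  have hi := hint hA.continuous hAs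
  have hi' := hint (contDiff_pspace hA i).continuous (hasCompactSupport_pspace hA hAs i)
  have key := integral_mul_fderiv_eq_neg_fderiv_mul_of_integrable (μ := volume) (f := e)
    (g := fun x => (A (r, x) : ℂ)) (v := Pi.single i 1)
    (by simpa only [hed, mul_assoc] using hi.const_mul (-(Complex.I * ξ i)))
    (by simpa only [hgd'] using hi') hi (fun x _ => he.differentiable one_ne_zero x)
    (fun x _ => (hgd x).differentiableAt)
  simp only [hgd', hed, mul_assoc, integral_const_mul] at key
  rw [key]
  simp only [e, neg_mul, neg_neg, mul_assoc]

theorem continuous_fourier_slice {d : ℕ} {A : ℝ × (Fin d → ℝ) → ℝ} (hA : Continuous A)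
    (hAs : HasCompactSupport A) (ξ : Fin d → ℝ) :
    Continuous fun r =>
      ∫ x, Complex.exp (-(Complex.I * ((∑ k, x k * ξ k : ℝ) : ℂ))) * (A (r, x) : ℂ) := by
  obtain ⟨R, M, -, -, -, hB⟩ := exists_uniform_bound hA hAs
  refine continuous_of_dominated (fun r => by fun_prop) (fun r => .of_forall fun x => ?_)
    (integrable_indicator_closedBall R M) (.of_forall fun x => by fun_prop)
  simpa [Complex.norm_exp] using hB r x

theorem hasDerivAt_fourier_slice {d : ℕ} {A : ℝ × (Fin d → ℝ) → ℝ}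
    (hA : ContDiff ℝ (⊤ : ℕ∞) A) (hAs : HasCompactSupport A) (ξ : Fin d → ℝ) (r : ℝ) :
    HasDerivAt
      (fun r => ∫ x, Complex.exp (-(Complex.I * ((∑ k, x k * ξ k : ℝ) : ℂ))) * (A (r, x) : ℂ))
      (∫ x, Complex.exp (-(Complex.I * ((∑ k, x k * ξ k : ℝ) : ℂ))) * (ptime A (r, x) : ℂ)) r := by
  have hAc := hA.continuous
  have hA'c := (contDiff_ptime hA).continuous
  obtain ⟨R, M, -, -, -, hB⟩ := exists_uniform_bound hA'c (hasCompactSupport_ptime hA hAs)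
  refine (hasDerivAt_integral_of_dominated_loc_of_deriv_le (s := univ)
    (F := fun r x => Complex.exp (-(Complex.I * ((∑ k, x k * ξ k : ℝ) : ℂ))) * (A (r, x) : ℂ))
    (F' := fun r x =>
      Complex.exp (-(Complex.I * ((∑ k, x k * ξ k : ℝ) : ℂ))) * (ptime A (r, x) : ℂ)) univ_mem
    (.of_forall fun r => by fun_prop)
    ((integrable_slice hAc hAs r).ofReal.bdd_mul (c := 1)
      (Continuous.aestronglyMeasurable (by fun_prop)) (.of_forall fun x => ?_))
    (by fun_prop) (.of_forall fun x t _ => ?_) (integrable_indicator_closedBall R M)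
    (.of_forall fun x t _ => ?_)).2
  · simp [Complex.norm_exp]
  · simpa [Complex.norm_exp] using hB t x
  · refine HasDerivAt.const_mul _ (HasDerivAt.ofReal_comp ?_)
    exact (((hA.comp (contDiff_prodMk_left x)).differentiable (by simp)) t).hasDerivAt

/-- representation formula for second spatial derivatives.
Under the same hypotheses as the representation formula, for all `i, j` and `(s,x)`,
`∂²_{xᵢxⱼ} u(s,x) = -∫_s^∞ dr ∫_{ℝᵈ} ∂²_{xᵢxⱼ} f(r, x+y) N(0, C_{sr})(dy)`. -/
theorem representation_formula_second_derivatives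
    (d : ℕ) (hd : 1 ≤ d)
    (c : ℝ → Matrix (Fin d) (Fin d) ℝ)
    (hmeas : ∀ i j, Measurable fun t => c t i j)
    (hloc : ∀ a b : ℝ, ∃ K : ℝ, ∀ t ∈ Set.Icc a b, ∀ i j, |c t i j| ≤ K)
    (hsymm : ∀ t, (c t).IsSymm)
    (hpos : ∀ t (ξ : Fin d → ℝ), 0 ≤ ∑ i, ∑ j, c t i j * ξ i * ξ j)
    (u f : ℝ × (Fin d → ℝ) → ℝ)
    (hu : ContDiff ℝ (⊤ : ℕ∞) u) (hsupp : HasCompactSupport u)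
    (heq : ∀ z : ℝ × (Fin d → ℝ),
      ptime u z + ∑ i, ∑ j, c z.1 i j * pspace2 i j u z = f z)
    (N : ℝ → ℝ → Measure (Fin d → ℝ))
    (hNprob : ∀ s r : ℝ, s ≤ r → IsProbabilityMeasure (N s r))
    (hNchar : ∀ s r : ℝ, s ≤ r → ∀ ξ : Fin d → ℝ,
      (∫ y, Complex.exp (Complex.I * ((∑ i, y i * ξ i : ℝ) : ℂ)) ∂(N s r))
        = Complex.exp (-((∑ i, ∑ j, (∫ t in s..r, c t i j) * ξ i * ξ j : ℝ) : ℂ)))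
    (i j : Fin d) (s : ℝ) (x : Fin d → ℝ) :
    pspace2 i j u (s, x)
      = - ∫ r in Set.Ioi s, (∫ y, pspace2 i j f (r, x + y) ∂(N s r)) := by
  have hcl (k l : Fin d) (a b : ℝ) : ∃ K : ℝ, ∀ t ∈ Icc a b, |c t k l| ≤ K :=
    (hloc a b).imp fun K hK t ht => hK t ht k l
  have hci (k l : Fin d) := intervalIntegrable_of_locally_bounded (hmeas k l) (hcl k l)
  have hprob (r : ℝ) : IsProbabilityMeasure (N s (max s r)) := hNprob s _ (le_max_left s r)
  have hcont := continuous_integral_of_continuous_charFun (P := fun r => N s (max s r)) fun ξ => by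
    simp only [hNchar s _ (le_max_left s _) ξ]
    have (k l : Fin d) : Continuous fun r => ∫ t in s..max s r, c t k l :=
      (intervalIntegral.continuous_primitive (hci k l) s).comp (by fun_prop)
    fun_prop
  set v := pspace2 i j u with hv_def
  have hv : ContDiff ℝ (⊤ : ℕ∞) v := contDiff_pspace (contDiff_pspace hu j) i
  have hvs : HasCompactSupport v :=
    hasCompactSupport_pspace (contDiff_pspace hu j) (hasCompactSupport_pspace hu hsupp j) i
  have h2 (k l : Fin d) : ContDiff ℝ (⊤ : ℕ∞) (pspace2 k l v) :=
    contDiff_pspace (contDiff_pspace hv l) k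
  have h2s (k l : Fin d) : HasCompactSupport (pspace2 k l v) :=
    hasCompactSupport_pspace (contDiff_pspace hv l) (hasCompactSupport_pspace hv hvs l) k
  have hcomm (k l : Fin d) : pspace2 i j (pspace2 k l u) = pspace2 k l v := by
    have hk := contDiff_pspace hu
    simp only [hv_def, pspace2]
    rw [pspace_comm (hk l) j k, pspace_comm hu j l, pspace_comm (contDiff_pspace (hk j) l) i k,
      pspace_comm (hk j) i l]
  have hf : pspace2 i j f = fun z => ptime v z + ∑ k, ∑ l, c z.1 k l * pspace2 k l v z := by
    have h2u (k l : Fin d) : ContDiff ℝ (⊤ : ℕ∞) (pspace2 k l u) :=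
      contDiff_pspace (contDiff_pspace hu l) k
    rw [← funext heq]
    simp only [← hcomm]
    rw [pspace2, pspace_add_sum (contDiff_ptime hu) h2u c j,
      pspace_add_sum (contDiff_pspace (contDiff_ptime hu) j)
        (fun k l => contDiff_pspace (h2u k l) j) c i,
      pspace_ptime_comm hu, pspace_ptime_comm (contDiff_pspace hu j)]
    rfl
  obtain ⟨hI₀, hC₀, hL₀, hF₀⟩ := time_integral_shiftMean hcont (contDiff_ptime hv).continuous
    (hasCompactSupport_ptime hv hvs) (b := fun _ => 1) measurable_const
    (fun _ => ⟨1, fun _ _ => by simp⟩) s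
  have hS (k l : Fin d) := time_integral_shiftMean hcont (h2 k l).continuous (h2s k l) (hmeas k l)
    (fun R => hcl k l (-R) R) s
  set P := fun r => N s (max s r) with hP
  let S₀ (x : Fin d → ℝ) : ℝ := ∫ r in Ioi s, 1 * shiftMean P (ptime v) r x
  let S (k l : Fin d) (x : Fin d → ℝ) : ℝ :=
    ∫ r in Ioi s, c r k l * shiftMean P (pspace2 k l v) r x
  have hrhs (x : Fin d → ℝ) : ∫ r in Ioi s, (∫ y, pspace2 i j f (r, x + y) ∂(N s r))
      = S₀ x + ∑ k, ∑ l, S k l x := by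
    have hb {A : ℝ × (Fin d → ℝ) → ℝ} (hA : Continuous A) (hAs : HasCompactSupport A) (r : ℝ) :
        Integrable (fun y => A (r, x + y)) (P r) := by
      obtain ⟨M, hM⟩ := hAs.exists_bound_of_continuous hA
      exact Integrable.of_bound (by fun_prop) M (.of_forall fun y => hM _)
    have hpt (r : ℝ) (hr : r ∈ Ioi s) : ∫ y, pspace2 i j f (r, x + y) ∂(N s r)
        = 1 * shiftMean P (ptime v) r x + ∑ k, ∑ l, c r k l * shiftMean P (pspace2 k l v) r x := by
      have hPr : N s r = P r := by simp only [hP, max_eq_right (le_of_lt (mem_Ioi.1 hr))]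
      have hi₀ := hb (contDiff_ptime hv).continuous (hasCompactSupport_ptime hv hvs) r
      have hi (k l : Fin d) := (hb (h2 k l).continuous (h2s k l) r).const_mul (c r k l)
      rw [hPr, hf]
      dsimp only
      rw [integral_add hi₀ (integrable_finsetSum _ fun k _ => integrable_finsetSum _ fun l _ =>
        hi k l), integral_finsetSum _ fun k _ => integrable_finsetSum _ fun l _ => hi k l]
      simp_rw [integral_finsetSum _ fun l _ => hi _ l, integral_const_mul]
      simp only [shiftMean, one_mul]
    rw [setIntegral_congr_fun measurableSet_Ioi hpt, integral_add (hI₀ x)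
      (integrable_finsetSum _ fun k _ => integrable_finsetSum _ fun l _ => (hS k l).1 x),
      integral_finsetSum _ fun k _ => integrable_finsetSum _ fun l _ => (hS k l).1 x]
    simp_rw [integral_finsetSum _ fun l _ => (hS _ l).1 x]
    rfl
  have hzero : (fun x => ((v (s, x) + (S₀ x + ∑ k, ∑ l, S k l x) : ℝ) : ℂ)) = 0 := by
    have hvi := integrable_slice hv.continuous hvs s
    have hSi := integrable_finsetSum Finset.univ fun k _ =>
      integrable_finsetSum Finset.univ fun l _ => (hS k l).2.2.1
    have hSc : Continuous fun x => ∑ k, ∑ l, S k l x :=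
      continuous_finsetSum _ fun k _ => continuous_finsetSum _ fun l _ => (hS k l).2.1
    refine eq_zero_of_fourier_eq_zero ?_ (hvi.add (hL₀.add hSi)).ofReal fun ξ => ?_
    · have hvc := hv.continuous
      have hC₀' : Continuous S₀ := hC₀
      fun_prop
    let e (x : Fin d → ℝ) : ℂ := Complex.exp (-(Complex.I * ((∑ k, x k * ξ k : ℝ) : ℂ)))
    have he {g : (Fin d → ℝ) → ℝ} (hg : Integrable g) : Integrable fun x => e x * (g x : ℂ) :=
      hg.ofReal.bdd_mul (c := 1) (by fun_prop) (.of_forall fun x => by simp [e, Complex.norm_exp])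
    let χ (r : ℝ) : ℂ := ∫ y, Complex.exp (Complex.I * ((∑ k, y k * ξ k : ℝ) : ℂ)) ∂(P r)
    let w (r : ℝ) : ℂ := ∫ x, e x * (v (r, x) : ℂ)
    let w' (r : ℝ) : ℂ := ∫ x, e x * (ptime v (r, x) : ℂ)
    let q (t : ℝ) : ℝ := ∑ k, ∑ l, c t k l * ξ k * ξ l
    have hw2 (k l : Fin d) (r : ℝ) : ∫ x, e x * (pspace2 k l v (r, x) : ℂ)
        = -(ξ k * ξ l) * w r := by
      rw [pspace2, fourier_pspace (contDiff_pspace hv l) (hasCompactSupport_pspace hv hvs l),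
        fourier_pspace hv hvs]
      linear_combination (ξ k * ξ l * w r) * Complex.I_mul_I
    have hχ (r : ℝ) (hr : r ∈ Ioi s) : χ r = Complex.exp (-((∫ t in s..r, q t : ℝ) : ℂ)) := by
      have hsr : s ≤ r := le_of_lt hr
      simp only [χ, hP, max_eq_right hsr]
      rw [hNchar s r hsr ξ, intervalIntegral.integral_finsetSum]
      · congr 3
        refine Finset.sum_congr rfl fun k _ => ?_
        rw [intervalIntegral.integral_finsetSum fun l _ => ((hci k l s r).mul_const _).mul_const _]
        simp only [intervalIntegral.integral_mul_const]
      · intro k _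
        simpa only [Finset.sum_fn] using IntervalIntegrable.sum _ fun l _ =>
          ((hci k l s r).mul_const (ξ k)).mul_const (ξ l)
    have hG : EqOn (fun r => ((1 : ℝ) : ℂ) * (χ r * w' r) +
        ∑ k, ∑ l, (c r k l : ℂ) * (χ r * ∫ x, e x * (pspace2 k l v (r, x) : ℂ)))
        (fun r => Complex.exp (-((∫ t in s..r, q t : ℝ) : ℂ)) * (w' r - q r * w r)) (Ioi s) := by
      intro r hr
      simp only [hw2, hχ r hr]
      generalize Complex.exp (-((∫ t in s..r, q t : ℝ) : ℂ)) = E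
      simp only [q]
      push_cast
      rw [one_mul, mul_sub, sub_eq_add_neg]
      congr 1
      rw [Finset.sum_mul, Finset.mul_sum, ← Finset.sum_neg_distrib]
      refine Finset.sum_congr rfl fun k _ => ?_
      rw [Finset.sum_mul, Finset.mul_sum, ← Finset.sum_neg_distrib]
      refine Finset.sum_congr rfl fun l _ => ?_
      ring
    have hFi (k l : Fin d) := ((hS k l).2.2.2 ξ).1
    have hGi := (hF₀ ξ).1.add (integrable_finsetSum Finset.univ fun k _ =>
      integrable_finsetSum Finset.univ fun l _ => hFi k l)
    have hsum : ∫ x, e x * ((S₀ x + ∑ k, ∑ l, S k l x : ℝ) : ℂ) = -w s := by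
      obtain ⟨R, -, -, -, hR, -⟩ := exists_uniform_bound hv.continuous hvs
      obtain ⟨R', -, -, -, hR', -⟩ := exists_uniform_bound (contDiff_ptime hv).continuous
        (hasCompactSupport_ptime hv hvs)
      rw [← integral_exp_neg_primitive_mul_complex (q := q) (w := w) (w' := w') (R := max R R')
        (by fun_prop) ?_ (hasDerivAt_fourier_slice hv hvs ξ)
        (continuous_fourier_slice (contDiff_ptime hv).continuous
          (hasCompactSupport_ptime hv hvs) ξ) ?_ s ?_, ← setIntegral_congr_fun measurableSet_Ioi hG,
        integral_add (hF₀ ξ).1 (integrable_finsetSum _ fun k _ => integrable_finsetSum _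
          fun l _ => hFi k l),
        integral_finsetSum _ fun k _ => integrable_finsetSum _ fun l _ => hFi k l]
      · simp_rw [integral_finsetSum _ fun l _ => hFi _ l]
        have hsplit (x : Fin d → ℝ) : e x * ((S₀ x + ∑ k, ∑ l, S k l x : ℝ) : ℂ)
            = e x * (S₀ x : ℂ) + ∑ k, ∑ l, e x * (S k l x : ℂ) := by
          simp only [Complex.ofReal_add, Complex.ofReal_sum, mul_add, Finset.mul_sum]
        simp_rw [hsplit]
        rw [integral_add (he hL₀) (integrable_finsetSum _ fun k _ => integrable_finsetSum _
            fun l _ => he (hS k l).2.2.1), (hF₀ ξ).2,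
          integral_finsetSum _ fun k _ => integrable_finsetSum _ fun l _ => he (hS k l).2.2.1]
        congr 1
        refine Finset.sum_congr rfl fun k _ => ?_
        rw [integral_finsetSum _ fun l _ => he (hS k l).2.2.1]
        exact Finset.sum_congr rfl fun l _ => ((hS k l).2.2.2 ξ).2
      · intro a b
        obtain ⟨K, hK⟩ := hloc a b
        refine ⟨∑ k, ∑ l, K * |ξ k| * |ξ l|, fun t ht => ?_⟩
        refine (Finset.abs_sum_le_sum_abs _ _).trans (Finset.sum_le_sum fun k _ => ?_)
        refine (Finset.abs_sum_le_sum_abs _ _).trans (Finset.sum_le_sum fun l _ => ?_)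
        rw [abs_mul, abs_mul]
        gcongr
        exact hK t ht k l
      · intro r hr
        have h1 : r ∉ Icc (-R) R := fun h => absurd h.2 (not_le.2 ((le_max_left _ _).trans_lt hr))
        have h2 : r ∉ Icc (-R') R' :=
          fun h => absurd h.2 (not_le.2 ((le_max_right _ _).trans_lt hr))
        simp [w, w', hR r h1, hR' r h2]
      · exact IntegrableOn.congr_fun hGi hG measurableSet_Ioi
    have : ∫ x, e x * ((v (s, x) + (S₀ x + ∑ k, ∑ l, S k l x) : ℝ) : ℂ) = w s + -w s := by
      have hSint : Integrable fun x => S₀ x + ∑ k, ∑ l, S k l x := hL₀.add hSi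
      rw [← hsum]
      refine Eq.trans ?_ (integral_add (he hvi) (he hSint))
      congr 1
      ext x
      push_cast
      ring
    rw [this, add_neg_cancel]
  have := congrFun hzero x
  rw [hrhs x]
  exact eq_neg_of_add_eq_zero_left (Complex.ofReal_eq_zero.1 this)
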